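/- Let E be an adhesive and κ-exhaustive category and u : J → Arr(E) a diagram with J small. Suppose the density comonad Den(u) : Arr(E) → Arr(E) (a) sends every arrow of E to an arrow whose underlying map is a monomorphism, (b) preserves monomorphisms of Arr(E), and (c) sends monomorphisms of Arr(E) to cartesian (pullback) squares in E. Then u is compatible with the κ-backdrop of monomorphisms of E; in particular, for every levelwise-monomorphism square (h, k) : f → g, the Leibniz pushout application of Den(u) at (h, k) is a monomorphism. -/

import Mathlib

open CategoryTheory Limits

universe w v u

namespace Paper
variable {E : Type u} [Category.{v} E]




/-- The index category for `α`-indexed chains: ordinals below `α`. -/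
abbrev ChainIdx (α : Ordinal.{w}) : Type (w + 1) := {β : Ordinal.{w} // β < α}


/-- A `κ`-backdrop on a category `E`: a wide subcategory `mor` such that `E` has colimits of
`α`-indexed chains of morphisms in `mor` for all `0 < α ≤ κ`, with `mor` closed under the
resulting transfinite composites, and `E` has pushouts of morphisms of `mor` along arbitrary
morphisms, with `mor` closed under cobase change. -/
structure Backdrop (κ : Ordinal.{w}) (E : Type u) [Category.{v} E] where
  mor : MorphismProperty E
  id_mem : ∀ X : E, mor (𝟙 X)
  comp_mem : ∀ {X Y Z : E} (f : X ⟶ Y) (g : Y ⟶ Z), mor f → mor g → mor (f ≫ g)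
  chain_colimit : ∀ (α : Ordinal.{w}), 0 < α → α ≤ κ → ∀ (F : ChainIdx α ⥤ E),
    (∀ (i j : ChainIdx α) (h : i ⟶ j), mor (F.map h)) → HasColimit F
  chain_closed : ∀ (α : Ordinal.{w}) (h0 : 0 < α), α ≤ κ → ∀ (F : ChainIdx α ⥤ E),
    (∀ (i j : ChainIdx α) (h : i ⟶ j), mor (F.map h)) →
    ∀ (c : Cocone F), IsColimit c → mor (c.ι.app ⟨0, h0⟩)
  pushout_exists : ∀ {X Y Z : E} (m : X ⟶ Y) (f : X ⟶ Z), mor m → HasPushout m f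
  pushout_closed : ∀ {X Y Z P : E} (f : X ⟶ Z) (m : X ⟶ Y) (n : Z ⟶ P) (g : Y ⟶ P),
    mor m → IsPushout f m n g → mor n

/-- An object `A` is `(κ, M)`-small when `Hom(A, -)` preserves `κ`-indexed colimits of chains
of morphisms in `M`. -/
def Backdrop.Small {κ : Ordinal.{w}} (B : Backdrop κ E) (A : E) : Prop :=
  ∀ (F : ChainIdx κ ⥤ E), (∀ (i j : ChainIdx κ) (h : i ⟶ j), B.mor (F.map h)) →
    ∀ (c : Cocone F), IsColimit c →
      Nonempty (IsColimit ((coyoneda.obj (Opposite.op A)).mapCocone c))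

/-- A pointed endofunctor. -/
structure PtdEndo (E : Type u) [Category.{v} E] where
  T : E ⥤ E
  pt : 𝟭 E ⟶ T

/-- A morphism of pointed endofunctors. -/
structure PtdEndoHom (P Q : PtdEndo E) where
  app : P.T ⟶ Q.T
  pt_comp : P.pt ≫ app = Q.pt

/-- A monad, presented explicitly. -/
structure MndStr (E : Type u) [Category.{v} E] where
  T : E ⥤ E
  η : 𝟭 E ⟶ T
  μ : T ⋙ T ⟶ T
  left_unit : ∀ X : E, η.app (T.obj X) ≫ μ.app X = 𝟙 (T.obj X)
  right_unit : ∀ X : E, T.map (η.app X) ≫ μ.app X = 𝟙 (T.obj X)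
  assoc : ∀ X : E, T.map (μ.app X) ≫ μ.app X = μ.app (T.obj X) ≫ μ.app X

/-- The pointed endofunctor underlying a monad. -/
def MndStr.toPtd (M : MndStr E) : PtdEndo E := ⟨M.T, M.η⟩

/-- A morphism of monads. -/
structure MndHom (M N : MndStr E) where
  app : M.T ⟶ N.T
  unit_comp : M.η ≫ app = N.η
  mul_comp : ∀ X : E, M.μ.app X ≫ app.app X
      = app.app (M.T.obj X) ≫ N.T.map (app.app X) ≫ N.μ.app X

/-- Algebras for a pointed endofunctor. -/
structure PtdAlg (P : PtdEndo E) where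
  X : E
  a : P.T.obj X ⟶ X
  unit : P.pt.app X ≫ a = 𝟙 X

/-- Morphisms of algebras for a pointed endofunctor. -/
@[ext]
structure PtdAlgHom {P : PtdEndo E} (A B : PtdAlg P) where
  f : A.X ⟶ B.X
  comm : P.T.map f ≫ B.a = A.a ≫ f

instance {P : PtdEndo E} : Category (PtdAlg P) where
  Hom := PtdAlgHom
  id A := ⟨𝟙 A.X, by simp⟩
  comp f g := ⟨f.f ≫ g.f, by
    rw [Functor.map_comp, Category.assoc, g.comm, ← Category.assoc, f.comm, Category.assoc]⟩
  id_comp f := by apply PtdAlgHom.ext; simp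
  comp_id f := by apply PtdAlgHom.ext; simp
  assoc f g h := by apply PtdAlgHom.ext; simp

/-- The forgetful functor from pointed-endofunctor algebras. -/
def PtdAlg.forget (P : PtdEndo E) : PtdAlg P ⥤ E where
  obj A := A.X
  map f := f.f


/-- `M` is the (algebraically) free monad on the pointed endofunctor `P`, via the canonical
morphism `γ`. -/
def IsFreeMonadOn (P : PtdEndo E) (M : MndStr E) (γ : PtdEndoHom P M.toPtd) : Prop :=
  ∀ (M' : MndStr E) (β : PtdEndoHom P M'.toPtd),
    ∃ α : MndHom M M', γ.app ≫ α.app = β.app ∧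
      ∀ α' : MndHom M M', γ.app ≫ α'.app = β.app → α'.app = α.app
variable {E : Type u} [Category.{v} E]

/-- The counit `ε : Den(u) ⟶ Id` of the density comonad, obtained from the universal property
of the left Kan extension of `u` along itself. -/
noncomputable def densityCounit {J : Type w} [SmallCategory J] (u : J ⥤ Arrow E)
    (Den : Arrow E ⥤ Arrow E) (net : u ⟶ u ⋙ Den) [Den.IsLeftKanExtension net] :
    Den ⟶ 𝟭 (Arrow E) :=
  Functor.descOfIsLeftKanExtension Den net (𝟭 (Arrow E)) u.rightUnitor.inv

/-- The diagram `u` is compatible with the backdrop `M`, with respect to a choice `Den` of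
density comonad: (a) `Den` is valued in `M`; (b) the Leibniz pushout application of `Den`
sends squares levelwise in `M` to morphisms in `M`. -/
def DenCompatible {κ : Ordinal.{w}} (B : Backdrop κ E) (Den : Arrow E ⥤ Arrow E) : Prop :=
  (∀ f : Arrow E, B.mor (Den.obj f).hom)
  ∧ (∀ {f g : Arrow E} (φ : f ⟶ g), B.mor φ.left → B.mor φ.right →
      ∀ {P : E} (inl : (Den.obj f).right ⟶ P) (inr : (Den.obj g).left ⟶ P),
        IsPushout (Den.obj f).hom (Den.map φ).left inl inr →
        ∀ gap : P ⟶ (Den.obj g).right,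
          inl ≫ gap = (Den.map φ).right → inr ≫ gap = (Den.obj g).hom → B.mor gap)
/-!  STATEMENT 17: compatibility with the backdrop of monomorphisms. -/

/-- In an adhesive category, a monomorphism between arrows that are monic is monic on codomains. -/
theorem mono_right_of_mono {E : Type u} [Category.{v} E] [Adhesive E] {f g : Arrow E}
    (hf : Mono f.hom) (hg : Mono g.hom) (φ : f ⟶ g) (hφ : Mono φ) : Mono φ.right where
  right_cancellation {Z} a b w := by
    have w' : a ≫ φ.right = b ≫ φ.right := w
    let pa := pullback.snd f.hom a
    let pb := pullback.snd f.hom b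
    have : Mono pa := inferInstanceAs (Mono (pullback.snd f.hom a))
    have ha : pullback.fst f.hom a ≫ f.hom = pa ≫ a := pullback.condition
    have hb : pullback.fst f.hom b ≫ f.hom = pb ≫ b := pullback.condition
    have hab : pullback.fst pa pb ≫ pa = pullback.snd pa pb ≫ pb := pullback.condition
    let α : Arrow.mk (pullback.fst pa pb ≫ pa) ⟶ f :=
      Arrow.homMk (pullback.fst pa pb ≫ pullback.fst f.hom a) a (by simp [ha])
    let β : Arrow.mk (pullback.fst pa pb ≫ pa) ⟶ f :=
      Arrow.homMk (pullback.snd pa pb ≫ pullback.fst f.hom b) b (by simp [hb, reassoc_of% hab])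
    have hr : (α ≫ φ).right = (β ≫ φ).right := w'
    have key : α ≫ φ = β ≫ φ := by
      refine Arrow.hom_ext _ _ ?_ hr
      rw [← cancel_mono g.hom]
      have h1 := Arrow.w (α ≫ φ)
      have h2 := Arrow.w (β ≫ φ)
      exact h1.trans ((congrArg _ hr).trans h2.symm)
    have := (cancel_mono φ).1 key
    exact congrArg (fun t => t.right) this

/-- **Proposition.** Let `E` be an adhesive and `κ`-exhaustive category (the latter encoded by
the hypothesis that the monomorphisms form a `κ`-backdrop `B`) and `u : J ⥤ Arr(E)` a diagram
with `J` small, with density comonad `Den = Lan_u u`. Suppose `Den` (a) sends every arrow of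
`E` to an arrow whose underlying map is a monomorphism, (b) preserves monomorphisms of
`Arr(E)`, and (c) sends monomorphisms of `Arr(E)` to cartesian squares in `E`. Then `u` is
compatible with the `κ`-backdrop of monomorphisms of `E`; in particular, for every
levelwise-monomorphism square `(h, k) : f ⟶ g`, the Leibniz pushout application of `Den` at
`(h, k)` is a monomorphism. -/
theorem mono_backdrop_compatible
    {E : Type u} [Category.{v} E] [Adhesive E]
    {J : Type v} [SmallCategory J] (u : J ⥤ Arrow E)
    {κ : Ordinal.{w}} (B : Backdrop κ E)
    (hmono : ∀ {X Y : E} (f : X ⟶ Y), B.mor f ↔ Mono f)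
    (Den : Arrow E ⥤ Arrow E) (net : u ⟶ u ⋙ Den) [Den.IsLeftKanExtension net]
    (ha : ∀ f : Arrow E, Mono (Den.obj f).hom)
    (hb : ∀ {f g : Arrow E} (φ : f ⟶ g), Mono φ → Mono (Den.map φ))
    (hc : ∀ {f g : Arrow E} (φ : f ⟶ g), Mono φ →
      IsPullback (Den.obj f).hom (Den.map φ).left (Den.map φ).right (Den.obj g).hom) :
    DenCompatible B Den := by
  refine ⟨fun f => (hmono _).2 (ha f), ?_⟩
  intro f g φ hl hr P inl inr hP gap h1 h2
  rw [hmono] at hl hr ⊢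
  have hφ : Mono φ := by
    refine ⟨fun a b h => Arrow.hom_ext _ _ ?_ ?_⟩
    · rw [← cancel_mono φ.left]
      exact congrArg (fun t => t.left) h
    · rw [← cancel_mono φ.right]
      exact congrArg (fun t => t.right) h
  have hm := hb φ hφ
  have hpb := hc φ hφ
  have hg := ha g
  have hR : Mono (Den.map φ).right := mono_right_of_mono (ha f) (ha g) _ hm
  let e := hpb.isoPullback
  have hP' : IsPushout (pullback.fst (Den.map φ).right (Den.obj g).hom)
      (pullback.snd (Den.map φ).right (Den.obj g).hom) inl inr :=
    hP.of_iso e (Iso.refl _) (Iso.refl _) (Iso.refl _)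
      (by simp [e]) (by simp [e]) (by simp) (by simp)
  have : gap = hP'.isoPushout.hom ≫
      pushout.desc (Den.map φ).right (Den.obj g).hom pullback.condition := by
    apply hP'.hom_ext
    · rw [h1, IsPushout.inl_isoPushout_hom_assoc]
      exact (pushout.inl_desc _ _ _).symm
    · rw [h2, IsPushout.inr_isoPushout_hom_assoc]
      exact (pushout.inr_desc _ _ _).symm
  rw [this]
  have : Mono (pushout.desc (Den.map φ).right (Den.obj g).hom pullback.condition) :=
    Adhesive.desc_mono_of_mono
  exact mono_comp _ _
end Paper
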